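/- Let α, β be the operators on V^⊗(2p−1) defined in the context, and set γ = (−1)^{p−1}([p−1]!)². Then α∘β∘α = γ·α and β∘α∘β = γ·β. -/

import Mathlib

noncomputable section

/-- The quantum integer `[n] = (q^n - q^{-n})/(q - q⁻¹)`. -/
def qint (q : ℂ) (n : ℤ) : ℂ := (q ^ n - q ^ (-n)) / (q - q⁻¹)

/-- The quantum factorial `[n]! = [1][2]⋯[n]`, with `[0]! = 1`. -/
def qfact (q : ℂ) (n : ℕ) : ℂ := ∏ m ∈ Finset.range n, qint q ((m : ℤ) + 1)

/-- Binary strings of length `z`, indexing the standard basis of `V^{⊗z}` for `V = ℂ²`: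
value `1` at a position means `ν₁` there, value `0` means `ν₀`. -/
abbrev Str (z : ℕ) := Fin z → Fin 2

/-- `V^{⊗z}`, modelled by coordinates with respect to the standard basis of tensors of
`ν₀`'s and `ν₁`'s. -/
abbrev Vz (z : ℕ) := Str z → ℂ

/-- The basis vector `ρ_{i₁,…,i_k,z}` of `V^{⊗z}` having `ν₁` exactly at the positions in `S`
and `ν₀` elsewhere. -/
def rho (z : ℕ) (S : Finset (Fin z)) : Vz z :=
  fun t => if t = (fun j => if j ∈ S then 1 else 0) then 1 else 0

/-- `x_{0,z} = ν₀^{⊗z}`. -/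
def x0 (z : ℕ) : Vz z := rho z ∅

/-- `x_{z,z} = ν₁^{⊗z}`. -/
def xtop (z : ℕ) : Vz z := rho z Finset.univ

/-- The set of positions of a basis string carrying `ν₁`. -/
def onesOf {z : ℕ} (s : Str z) : Finset (Fin z) := Finset.univ.filter fun j => s j = 1

/-- `i₁ + ⋯ + i_k`, the sum of the (1-indexed) positions in `S`. -/
def posSum {z : ℕ} (S : Finset (Fin z)) : ℤ := ∑ j ∈ S, (((j : ℕ) : ℤ) + 1)

/-- The `K`-weight exponent of a basis vector of `V`: `Kν₀ = qν₀`, `Kν₁ = q⁻¹ν₁`. -/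
def kwt (v : Fin 2) : ℤ := if v = 0 then 1 else -1

/-- Matrix of `E_z = Σᵢ 1^{⊗(i-1)} ⊗ E ⊗ K^{⊗(z-i)}` on `V^{⊗z}`. -/
def Emat (q : ℂ) (z : ℕ) : Matrix (Str z) (Str z) ℂ := fun t s =>
  ∑ i : Fin z,
    if s i = 1 ∧ t = Function.update s i 0 then
      q ^ (∑ j ∈ Finset.univ.filter (fun j => i < j), kwt (s j)) else 0

/-- Matrix of `F_z = Σᵢ (K⁻¹)^{⊗(i-1)} ⊗ F ⊗ 1^{⊗(z-i)}` on `V^{⊗z}`. -/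
def Fmat (q : ℂ) (z : ℕ) : Matrix (Str z) (Str z) ℂ := fun t s =>
  ∑ i : Fin z,
    if s i = 0 ∧ t = Function.update s i 1 then
      q ^ (-∑ j ∈ Finset.univ.filter (fun j => j < i), kwt (s j)) else 0

/-- `E_z` as a linear operator on `V^{⊗z}`. -/
def EOp (q : ℂ) (z : ℕ) : Module.End ℂ (Vz z) := (Emat q z).mulVecLin

/-- `F_z` as a linear operator on `V^{⊗z}`. -/
def FOp (q : ℂ) (z : ℕ) : Module.End ℂ (Vz z) := (Fmat q z).mulVecLin

/-- Matrix of the map `α : V^{⊗(2p-1)} → V^{⊗(2p-1)}`, with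
`α(ρ_{i₁,…,i_k,2p-1}) = q^{k(2p-1) - (k²-k)/2 - Σᵢ iⱼ}·[k]!·E_{2p-1}^{p-k-1} x_{2p-1,2p-1}`
for `k ≤ p-1`, and `α(ρ_{i₁,…,i_k,2p-1}) = 0` for `k ≥ p`. -/
def alphaMat (q : ℂ) (p : ℕ) : Matrix (Str (2 * p - 1)) (Str (2 * p - 1)) ℂ := fun t s =>
  let k := (onesOf s).card
  if k < p then
    (q ^ ((k : ℤ) * ((2 * p - 1 : ℕ) : ℤ) - ((k : ℤ) ^ 2 - (k : ℤ)) / 2 - posSum (onesOf s))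
        * qfact q k)
      * ((EOp q (2 * p - 1) ^ (p - 1 - k)) (xtop (2 * p - 1)) t)
  else 0

/-- Matrix of the map `β : V^{⊗(2p-1)} → V^{⊗(2p-1)}`, with
`β(ρ_{i₁,…,i_k,2p-1}) = q^{k(2p-1) - (k²-k)/2 - Σᵢ iⱼ}·[2p-1-k]!·F_{2p-1}^{k-p} x_{0,2p-1}`
for `k ≥ p`, and `β(ρ_{i₁,…,i_k,2p-1}) = 0` for `k ≤ p-1`. -/
def betaMat (q : ℂ) (p : ℕ) : Matrix (Str (2 * p - 1)) (Str (2 * p - 1)) ℂ := fun t s =>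
  let k := (onesOf s).card
  if p ≤ k then
    (q ^ ((k : ℤ) * ((2 * p - 1 : ℕ) : ℤ) - ((k : ℤ) ^ 2 - (k : ℤ)) / 2 - posSum (onesOf s))
        * qfact q (2 * p - 1 - k))
      * ((FOp q (2 * p - 1) ^ (k - p)) (x0 (2 * p - 1)) t)
  else 0

/-- The operator `α` on `V^{⊗(2p-1)}`. -/
def alphaOp (q : ℂ) (p : ℕ) : Module.End ℂ (Vz (2 * p - 1)) := (alphaMat q p).mulVecLin

/-- The operator `β` on `V^{⊗(2p-1)}`. -/
def betaOp (q : ℂ) (p : ℕ) : Module.End ℂ (Vz (2 * p - 1)) := (betaMat q p).mulVecLin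

/-- `1^{⊗a} ⊗ M ⊗ 1^{⊗(n-a-c)}`: the amplification of a matrix `M` acting on `c` tensor
factors to `V^{⊗n}`, placed on the factor positions `a+1, …, a+c` (1-indexed). -/
def ampMat (n a c : ℕ) (h : a + c ≤ n) (M : Matrix (Str c) (Str c) ℂ) :
    Matrix (Str n) (Str n) ℂ := fun t s =>
  if ∀ j : Fin n, ((j : ℕ) < a ∨ a + c ≤ (j : ℕ)) → t j = s j then
    M (fun j => t ⟨a + (j : ℕ), by have := j.isLt; omega⟩)
      (fun j => s ⟨a + (j : ℕ), by have := j.isLt; omega⟩)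
  else 0

/-- `α_i = 1^{⊗(i-1)} ⊗ α ⊗ 1^{⊗(n-2p+2-i)}` on `V^{⊗n}` (with `i` 1-indexed). -/
def alphaOpAt (q : ℂ) (p n i : ℕ) (h : (i - 1) + (2 * p - 1) ≤ n) : Module.End ℂ (Vz n) :=
  (ampMat n (i - 1) (2 * p - 1) h (alphaMat q p)).mulVecLin

/-- `β_i = 1^{⊗(i-1)} ⊗ β ⊗ 1^{⊗(n-2p+2-i)}` on `V^{⊗n}` (with `i` 1-indexed). -/
def betaOpAt (q : ℂ) (p n i : ℕ) (h : (i - 1) + (2 * p - 1) ≤ n) : Module.End ℂ (Vz n) :=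
  (ampMat n (i - 1) (2 * p - 1) h (betaMat q p)).mulVecLin

/-- Matrix of `∪` applied at the (0-indexed) positions `i, i+1` of `N = M + 2` strands:
`∪(ν₀⊗ν₀) = ∪(ν₁⊗ν₁) = 0`, `∪(ν₁⊗ν₀) = 1`, `∪(ν₀⊗ν₁) = -q`. -/
def cupMat (q : ℂ) (N M i : ℕ) (h : N = M + 2) (hi : i + 1 < N) :
    Matrix (Str M) (Str N) ℂ := fun t s =>
  if ∀ j : Fin M,
      t j = s ⟨if (j : ℕ) < i then (j : ℕ) else (j : ℕ) + 2, by
        have := j.isLt; split <;> omega⟩ then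
    (if s ⟨i, by omega⟩ = 1 ∧ s ⟨i + 1, hi⟩ = 0 then 1
     else if s ⟨i, by omega⟩ = 0 ∧ s ⟨i + 1, hi⟩ = 1 then -q
     else 0)
  else 0

/-- Matrix of `∩` inserted at the (0-indexed) positions `i, i+1` of `N = M + 2` strands:
`∩(1) = q⁻¹ ν₁⊗ν₀ - ν₀⊗ν₁`. -/
def capMat (q : ℂ) (N M i : ℕ) (h : N = M + 2) (hi : i + 1 < N) :
    Matrix (Str N) (Str M) ℂ := fun t s =>
  if ∀ j : Fin M,
      s j = t ⟨if (j : ℕ) < i then (j : ℕ) else (j : ℕ) + 2, by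
        have := j.isLt; split <;> omega⟩ then
    (if t ⟨i, by omega⟩ = 1 ∧ t ⟨i + 1, hi⟩ = 0 then q⁻¹
     else if t ⟨i, by omega⟩ = 0 ∧ t ⟨i + 1, hi⟩ = 1 then -1
     else 0)
  else 0

/-- `∪_{i+1} : V^{⊗N} → V^{⊗M}`, `N = M + 2` (here `i` is the 0-indexed position). -/
def cupOp (q : ℂ) (N M i : ℕ) (h : N = M + 2) (hi : i + 1 < N) : Vz N →ₗ[ℂ] Vz M :=
  (cupMat q N M i h hi).mulVecLin

/-- `∩_{i+1} : V^{⊗M} → V^{⊗N}`, `N = M + 2` (here `i` is the 0-indexed position). -/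
def capOp (q : ℂ) (N M i : ℕ) (h : N = M + 2) (hi : i + 1 < N) : Vz M →ₗ[ℂ] Vz N :=
  (capMat q N M i h hi).mulVecLin

/-- Matrix of the Jones–Wenzl-type map `G_n` on `V^{⊗n}`:
`G_n(ρ_{i₁,…,i_k,n}) = q^{kn - (k²-k)/2 - Σ iⱼ}·([n-k]!/[n]!)·F_n^k x_{0,n}`. -/
def jwMat (q : ℂ) (n : ℕ) : Matrix (Str n) (Str n) ℂ := fun t s =>
  let k := (onesOf s).card
  (q ^ ((k : ℤ) * (n : ℤ) - ((k : ℤ) ^ 2 - (k : ℤ)) / 2 - posSum (onesOf s))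
      * (qfact q (n - k) / qfact q n))
    * ((FOp q n ^ k) (x0 n) t)

/-- The Jones–Wenzl-type map `G_n` on `V^{⊗n}`. -/
def jwOp (q : ℂ) (n : ℕ) : Module.End ℂ (Vz n) := (jwMat q n).mulVecLin

/-- `v ⊗ ν_a : V^{⊗z} ⊗ V → V^{⊗(z+1)}` (appending a basis vector of `V` on the right). -/
def appendR {z : ℕ} (v : Vz z) (a : Fin 2) : Vz (z + 1) :=
  fun t => if t (Fin.last z) = a then v (fun j => t j.castSucc) else 0

/-- `ν_a ⊗ v : V ⊗ V^{⊗z} → V^{⊗(z+1)}` (appending a basis vector of `V` on the left). -/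
def appendL {z : ℕ} (a : Fin 2) (v : Vz z) : Vz (z + 1) :=
  fun t => if t 0 = a then v (fun j => t j.succ) else 0

/-- `ξ_{n,z} = Σ_{1 ≤ i₁ < ⋯ < i_n ≤ z} q^{-2(i₁+⋯+i_n)}`. -/
def xiSum (q : ℂ) (n z : ℕ) : ℂ :=
  ∑ S ∈ Finset.powersetCard n (Finset.univ : Finset (Fin z)), q ^ (-2 * posSum S)

open Finset

section Combinatorics

theorem sum_card_filter_gt {ι M : Type*} [LinearOrder ι] [AddCommMonoid M] (f : ℕ → M)
    (S : Finset ι) :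
    ∑ i ∈ S, f #{j ∈ S | i < j} = ∑ r ∈ range #S, f r := by
  induction S using Finset.induction_on_min with
  | empty => simp
  | insert a S ha ih =>
    have hnot : a ∉ S := fun h => lt_irrefl a (ha a h)
    rw [sum_insert hnot, card_insert_of_notMem hnot, sum_range_succ, add_comm, ← ih]
    congr 1
    · refine sum_congr rfl fun i hi => ?_
      rw [filter_insert, if_neg (ha i hi).not_gt]
    · rw [filter_insert, if_neg (lt_irrefl a), filter_true_of_mem ha]

theorem sum_card_filter_lt {ι M : Type*} [LinearOrder ι] [AddCommMonoid M] (f : ℕ → M)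
    (S : Finset ι) :
    ∑ i ∈ S, f #{j ∈ S | j < i} = ∑ r ∈ range #S, f r :=
  sum_card_filter_gt (ι := ιᵒᵈ) f S

end Combinatorics

section QuantumIntegers

theorem sum_zpow_eq_qint {q : ℂ} (h0 : q ≠ 0) (hq : q - q⁻¹ ≠ 0) (n : ℕ) :
    ∑ r ∈ range n, q ^ ((n : ℤ) - 1 - 2 * (r : ℤ)) = qint q n := by
  rw [qint, eq_div_iff hq, sum_mul]
  have h (r : ℕ) : q ^ ((n : ℤ) - 1 - 2 * (r : ℤ)) * (q - q⁻¹) =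
      q ^ ((n : ℤ) - 2 * (r : ℤ)) - q ^ ((n : ℤ) - 2 * ((r + 1 : ℕ) : ℤ)) := by
    rw [mul_sub, ← zpow_add_one₀ h0, ← zpow_sub_one₀ h0]
    push_cast
    ring_nf
  simp_rw [h]
  rw [sum_range_sub' (fun r : ℕ => q ^ ((n : ℤ) - 2 * (r : ℤ)))]
  congr 2
  ring

theorem qint_sub_of_pow_eq_neg_one {q : ℂ} (h0 : q ≠ 0) {p : ℕ} (h : q ^ p = -1) (n : ℤ) :
    qint q (p - n) = qint q n := by
  have h' : q ^ (p : ℤ) = -1 := by rw [zpow_natCast, h]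
  have e : -((p : ℤ) - n) = n - p := by ring
  rw [qint, qint, e, zpow_sub₀ h0, zpow_sub₀ h0, h', zpow_neg]
  ring

theorem qint_two_mul_sub_of_pow_eq_neg_one {q : ℂ} (h0 : q ≠ 0) {p : ℕ} (h : q ^ p = -1)
    (n : ℤ) : qint q (2 * p - n) = -qint q n := by
  have e : (2 * p - n : ℤ) = p - (n - p) := by ring
  have h' : q ^ (p : ℤ) = -1 := by rw [zpow_natCast, h]
  rw [e, qint_sub_of_pow_eq_neg_one h0 h, qint, qint, neg_sub, zpow_sub₀ h0, zpow_sub₀ h0, h',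
    zpow_neg]
  ring

theorem qfact_succ (q : ℂ) (n : ℕ) : qfact q (n + 1) = qfact q n * qint q ((n : ℤ) + 1) :=
  prod_range_succ _ _

theorem prod_qint_sub {q : ℂ} (h0 : q ≠ 0) {p : ℕ} (hp : 1 ≤ p) (h : q ^ p = -1) (m : ℕ) :
    ∏ j ∈ range m, qint q (((2 * p - 1 : ℕ) : ℤ) - j) = (-1) ^ m * qfact q m := by
  have e (j : ℕ) : qint q (((2 * p - 1 : ℕ) : ℤ) - j) = (-1) * qint q ((j : ℤ) + 1) := by
    rw [neg_one_mul, ← qint_two_mul_sub_of_pow_eq_neg_one h0 h]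
    congr 1
    omega
  simp_rw [e]
  rw [prod_mul_distrib, prod_const, card_range, qfact]

theorem qfact_add_of_pow_eq_neg_one {q : ℂ} (h0 : q ≠ 0) {p : ℕ} (h : q ^ p = -1) {m k : ℕ}
    (hmk : m + k + 1 = p) : qfact q (p - 1) = qfact q m * qfact q k := by
  rw [show p - 1 = m + k by omega, qfact, prod_range_add, ← qfact]
  congr 1
  rw [← prod_range_reflect, qfact]
  refine prod_congr rfl fun j hj => ?_
  rw [mem_range] at hj
  rw [← qint_sub_of_pow_eq_neg_one h0 h]
  congr 1
  omega

end QuantumIntegers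

section Strings

variable {z : ℕ}

theorem onesOf_update_one (s : Str z) (i : Fin z) :
    onesOf (Function.update s i 1) = insert i (onesOf s) := by
  ext j
  by_cases h : j = i <;> simp [onesOf, Function.update_apply, h]

theorem onesOf_update_zero (s : Str z) (i : Fin z) :
    onesOf (Function.update s i 0) = (onesOf s).erase i := by
  ext j
  by_cases h : j = i <;> simp [onesOf, Function.update_apply, h]

/-- The exponent of `q` in the coefficient of `α` and `β` at a basis string. -/
def stringExp (s : Str z) : ℤ :=
  (#(onesOf s) : ℤ) * (z : ℤ) - ((#(onesOf s) : ℤ) ^ 2 - (#(onesOf s) : ℤ)) / 2 -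
    posSum (onesOf s)

theorem sq_sub_self_ediv_two_succ (k : ℤ) :
    ((k + 1) ^ 2 - (k + 1)) / 2 = (k ^ 2 - k) / 2 + k := by
  rw [show (k + 1) ^ 2 - (k + 1) = (k ^ 2 - k) + k * 2 by ring,
    Int.add_mul_ediv_right _ _ two_ne_zero]

theorem stringExp_update_one (s : Str z) (i : Fin z) (hi : s i = 0) :
    stringExp (Function.update s i 1) = stringExp s + z - #(onesOf s) - (i : ℕ) - 1 := by
  have hn : i ∉ onesOf s := by simp [onesOf, hi]
  rw [stringExp, stringExp, onesOf_update_one, card_insert_of_notMem hn, posSum, posSum,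
    sum_insert hn]
  push_cast
  rw [sq_sub_self_ediv_two_succ]
  ring

theorem stringExp_update_zero (s : Str z) (i : Fin z) (hi : s i = 1) :
    stringExp (Function.update s i 0) = stringExp s - z + #(onesOf s) + (i : ℕ) := by
  have h := stringExp_update_one (Function.update s i 0) i (by simp)
  have hm : i ∈ onesOf s := by simp [onesOf, hi]
  rw [Function.update_idem, ← hi, Function.update_eq_self, onesOf_update_zero,
    card_erase_of_mem hm] at h
  have := card_pos.2 ⟨i, hm⟩
  omega

theorem sum_kwt_gt (s : Str z) (i : Fin z) :
    ∑ j ∈ univ.filter (fun j => i < j), kwt (s j) =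
      (z : ℤ) - 1 - (i : ℕ) - 2 * #{j ∈ onesOf s | i < j} := by
  have e (v : Fin 2) : kwt v = 1 - 2 * (if v = 1 then 1 else 0) := by
    fin_cases v <;> simp [kwt]
  simp_rw [e]
  rw [sum_sub_distrib, ← mul_sum, sum_boole, filter_filter, onesOf, filter_filter]
  simp_rw [and_comm (a := i < _)]
  have hc : #{j : Fin z | i < j} = z - 1 - i := by
    rw [filter_lt_eq_Ioi, Fin.card_Ioi]
  rw [sum_const, hc]
  have := i.isLt
  simp
  omega

theorem sum_kwt_lt (s : Str z) (i : Fin z) :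
    ∑ j ∈ univ.filter (fun j => j < i), kwt (s j) =
      2 * #{j ∈ (onesOf s)ᶜ | j < i} - (i : ℕ) := by
  have e (v : Fin 2) : kwt v = 2 * (if ¬ v = 1 then 1 else 0) - 1 := by
    fin_cases v <;> simp [kwt]
  simp_rw [e]
  rw [sum_sub_distrib, ← mul_sum, sum_boole, filter_filter, onesOf, compl_filter, filter_filter]
  simp_rw [and_comm (b := _ < i)]
  have hc : #{j : Fin z | j < i} = (i : ℕ) := by
    rw [filter_gt_eq_Iio, Fin.card_Iio]
  rw [sum_const, hc]
  simp

end Strings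

section Functionals

variable {z : ℕ}

/-- The row vector supported on strings with `k` ones through which `α` and `β` factor. -/
def weightRow (q : ℂ) (z k : ℕ) : Vz z :=
  fun s => if #(onesOf s) = k then q ^ stringExp s else 0

open Matrix

theorem weightRow_vecMul_Emat {q : ℂ} (h0 : q ≠ 0) (hq : q - q⁻¹ ≠ 0) (k : ℕ) :
    weightRow q z k ᵥ* Emat q z = qint q ((k : ℤ) + 1) • weightRow q z (k + 1) := by
  ext s
  have h1 : (weightRow q z k ᵥ* Emat q z) s = ∑ i ∈ onesOf s,
      weightRow q z k (Function.update s i 0) *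
        q ^ (∑ j ∈ univ.filter (fun j => i < j), kwt (s j)) := by
    simp only [vecMul, dotProduct, Emat, mul_sum, onesOf, sum_filter]
    rw [sum_comm]
    refine sum_congr rfl fun i _ => ?_
    by_cases hi : s i = 1 <;> simp [hi]
  rw [h1, Pi.smul_apply, smul_eq_mul]
  by_cases hk : #(onesOf s) = k + 1
  · have h2 : ∀ i ∈ onesOf s, weightRow q z k (Function.update s i 0) *
        q ^ (∑ j ∈ univ.filter (fun j => i < j), kwt (s j)) =
        q ^ ((k + 1 : ℕ) - 1 - 2 * (#{j ∈ onesOf s | i < j} : ℤ)) * q ^ stringExp s := by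
      intro i hi
      have hi' : s i = 1 := by simpa [onesOf] using hi
      rw [weightRow, onesOf_update_zero, card_erase_of_mem hi, hk, if_pos (by omega),
        stringExp_update_zero s i hi', sum_kwt_gt, ← zpow_add₀ h0, ← zpow_add₀ h0, hk]
      congr 1
      push_cast
      ring
    rw [sum_congr rfl h2, ← sum_mul,
      sum_card_filter_gt (fun r => q ^ (((k + 1 : ℕ) : ℤ) - 1 - 2 * (r : ℤ))), hk,
      sum_zpow_eq_qint h0 hq, weightRow, if_pos hk]
    push_cast
    rfl
  · rw [weightRow, if_neg hk, mul_zero]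
    refine sum_eq_zero fun i hi => ?_
    have := card_pos.2 ⟨i, hi⟩
    rw [weightRow, onesOf_update_zero, card_erase_of_mem hi, if_neg (by omega), zero_mul]

theorem weightRow_vecMul_Fmat_apply (q : ℂ) (k : ℕ) (s : Str z) :
    (weightRow q z k ᵥ* Fmat q z) s = ∑ i ∈ (onesOf s)ᶜ,
      weightRow q z k (Function.update s i 1) *
        q ^ (-∑ j ∈ univ.filter (fun j => j < i), kwt (s j)) := by
  simp only [vecMul, dotProduct, Fmat, mul_sum, onesOf, compl_filter, sum_filter]
  rw [sum_comm]
  refine sum_congr rfl fun i _ => ?_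
  have e : s i = 0 ↔ ¬ s i = 1 := by omega
  by_cases hi : s i = 1 <;> simp [hi, e]

theorem weightRow_zero_vecMul_Fmat (q : ℂ) : weightRow q z 0 ᵥ* Fmat q z = 0 := by
  ext s
  rw [weightRow_vecMul_Fmat_apply]
  refine sum_eq_zero fun i hi => ?_
  rw [weightRow, onesOf_update_one, if_neg (by simp), zero_mul]

theorem weightRow_succ_vecMul_Fmat {q : ℂ} (h0 : q ≠ 0) (hq : q - q⁻¹ ≠ 0) (k : ℕ) :
    weightRow q z (k + 1) ᵥ* Fmat q z = qint q ((z : ℤ) - k) • weightRow q z k := by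
  ext s
  rw [weightRow_vecMul_Fmat_apply, Pi.smul_apply, smul_eq_mul]
  by_cases hk : #(onesOf s) = k
  · have hz : #(onesOf s)ᶜ = z - k := by rw [card_compl, Fintype.card_fin, hk]
    have hkz : k ≤ z := by simpa [hk] using card_le_univ (onesOf s)
    have h2 : ∀ i ∈ (onesOf s)ᶜ, weightRow q z (k + 1) (Function.update s i 1) *
        q ^ (-∑ j ∈ univ.filter (fun j => j < i), kwt (s j)) =
        q ^ (((z - k : ℕ) : ℤ) - 1 - 2 * (#{j ∈ (onesOf s)ᶜ | j < i} : ℤ)) *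
          q ^ stringExp s := by
      intro i hi
      have hi' : s i = 0 := by
        have : ¬ s i = 1 := by simpa [onesOf] using hi
        omega
      rw [weightRow, onesOf_update_one, card_insert_of_notMem (mem_compl.1 hi), hk, if_pos rfl,
        stringExp_update_one s i hi', sum_kwt_lt, ← zpow_add₀ h0, ← zpow_add₀ h0, hk]
      congr 1
      push_cast [hkz]
      ring
    rw [sum_congr rfl h2, ← sum_mul,
      sum_card_filter_lt (fun r => q ^ (((z - k : ℕ) : ℤ) - 1 - 2 * (r : ℤ))), hz,
      sum_zpow_eq_qint h0 hq, weightRow, if_pos hk]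
    push_cast [hkz]
    rfl
  · rw [weightRow, if_neg hk, mul_zero]
    refine sum_eq_zero fun i hi => ?_
    rw [weightRow, onesOf_update_one, card_insert_of_notMem (mem_compl.1 hi), if_neg (by omega),
      zero_mul]

theorem weightRow_dotProduct_rho (q : ℂ) (k : ℕ) (S : Finset (Fin z)) :
    weightRow q z k ⬝ᵥ rho z S = weightRow q z k (fun j => if j ∈ S then 1 else 0) := by
  simp [dotProduct, rho]

theorem weightRow_dotProduct_x0 (q : ℂ) (k : ℕ) :
    weightRow q z k ⬝ᵥ x0 z = if k = 0 then 1 else 0 := by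
  have h : onesOf (fun _ : Fin z => (0 : Fin 2)) = ∅ := by simp [onesOf]
  rw [x0, weightRow_dotProduct_rho]
  simp [weightRow, stringExp, h, posSum, eq_comm]

theorem posSum_univ (z : ℕ) : posSum (univ : Finset (Fin z)) * 2 = (z : ℤ) * (z + 1) := by
  rw [posSum, Fin.sum_univ_eq_sum_range (fun j : ℕ => (j : ℤ) + 1)]
  induction z with
  | zero => simp
  | succ n ih => rw [sum_range_succ, add_mul, ih]; push_cast; ring

theorem weightRow_dotProduct_xtop (q : ℂ) (k : ℕ) :
    weightRow q z k ⬝ᵥ xtop z = if k = z then 1 else 0 := by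
  have h : onesOf (fun _ : Fin z => (1 : Fin 2)) = univ := by simp [onesOf]
  have he : (z : ℤ) * z - ((z : ℤ) ^ 2 - z) / 2 - posSum (univ : Finset (Fin z)) = 0 := by
    have hev : ((z : ℤ) ^ 2 - z) / 2 * 2 = (z : ℤ) ^ 2 - z := by
      refine Int.ediv_mul_cancel ?_
      rw [sq, ← mul_sub_one]
      exact (Int.even_mul_pred_self _).two_dvd
    linarith [posSum_univ z]
  rw [xtop, weightRow_dotProduct_rho]
  simp [weightRow, stringExp, h, he, eq_comm]

theorem weightRow_dotProduct_FOp_pow_x0 {q : ℂ} (h0 : q ≠ 0) (hq : q - q⁻¹ ≠ 0) (m k : ℕ) :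
    weightRow q z k ⬝ᵥ (FOp q z ^ m) (x0 z) =
      if k = m then ∏ j ∈ range m, qint q ((z : ℤ) - j) else 0 := by
  induction m generalizing k with
  | zero => simpa using weightRow_dotProduct_x0 q k
  | succ m ih =>
    rw [pow_succ', Module.End.mul_apply, FOp, mulVecLin_apply, dotProduct_mulVec, ← FOp]
    cases k with
    | zero => rw [weightRow_zero_vecMul_Fmat]; simp
    | succ k =>
      rw [weightRow_succ_vecMul_Fmat h0 hq, smul_dotProduct, ih, smul_eq_mul, prod_range_succ]
      by_cases h : k = m
      · simp [h, mul_comm]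
      · simp [h]

theorem weightRow_dotProduct_EOp_pow_xtop {q : ℂ} (h0 : q ≠ 0) (hq : q - q⁻¹ ≠ 0) (m k : ℕ) :
    weightRow q z k ⬝ᵥ (EOp q z ^ m) (xtop z) =
      if k + m = z then ∏ j ∈ range m, qint q ((z : ℤ) - j) else 0 := by
  induction m generalizing k with
  | zero => simpa using weightRow_dotProduct_xtop q k
  | succ m ih =>
    rw [pow_succ', Module.End.mul_apply, EOp, mulVecLin_apply, dotProduct_mulVec, ← EOp,
      weightRow_vecMul_Emat h0 hq, smul_dotProduct, ih, smul_eq_mul, prod_range_succ]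
    by_cases h : k + 1 + m = z
    · rw [if_pos h, if_pos (by omega), mul_comm]
      congr 2
      omega
    · rw [if_neg h, if_neg (by omega), mul_zero]

end Functionals

section AlphaBeta

open Matrix

theorem alphaOp_apply (q : ℂ) (p : ℕ) (v : Vz (2 * p - 1)) :
    alphaOp q p v = ∑ k ∈ range p, (qfact q k * (weightRow q (2 * p - 1) k ⬝ᵥ v)) •
      (EOp q (2 * p - 1) ^ (p - 1 - k)) (xtop (2 * p - 1)) := by
  ext t
  simp only [alphaOp, mulVecLin_apply, mulVec, dotProduct, Finset.sum_apply, Pi.smul_apply,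
    smul_eq_mul, mul_sum, sum_mul]
  rw [sum_comm]
  refine sum_congr rfl fun s _ => ?_
  by_cases h : #(onesOf s) < p
  · rw [sum_eq_single_of_mem _ (mem_range.2 h)
      (fun k _ hk => by rw [weightRow, if_neg hk.symm]; ring)]
    simp only [alphaMat, weightRow, stringExp, if_pos h, if_true]
    ring
  · rw [sum_eq_zero fun k hk => by
      rw [mem_range] at hk
      rw [weightRow, if_neg (by omega)]
      ring]
    simp [alphaMat, h]

theorem betaOp_apply (q : ℂ) {p : ℕ} (hp : 1 ≤ p) (v : Vz (2 * p - 1)) :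
    betaOp q p v = ∑ m ∈ range p,
      (qfact q m * (weightRow q (2 * p - 1) (2 * p - 1 - m) ⬝ᵥ v)) •
        (FOp q (2 * p - 1) ^ (p - 1 - m)) (x0 (2 * p - 1)) := by
  ext t
  simp only [betaOp, mulVecLin_apply, mulVec, dotProduct, Finset.sum_apply, Pi.smul_apply,
    smul_eq_mul, mul_sum, sum_mul]
  rw [sum_comm]
  refine sum_congr rfl fun s _ => ?_
  have hle : #(onesOf s) ≤ 2 * p - 1 := by simpa using card_le_univ (onesOf s)
  by_cases h : p ≤ #(onesOf s)
  · have hmem : 2 * p - 1 - #(onesOf s) ∈ range p := mem_range.2 (by omega)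
    rw [sum_eq_single_of_mem _ hmem
      (fun k hk hne => by
        rw [mem_range] at hk
        rw [weightRow, if_neg (by omega)]
        ring)]
    have e1 : #(onesOf s) = 2 * p - 1 - (2 * p - 1 - #(onesOf s)) := by omega
    have e2 : p - 1 - (2 * p - 1 - #(onesOf s)) = #(onesOf s) - p := by omega
    simp only [betaMat, weightRow, stringExp, if_pos h, if_pos e1, e2]
    ring
  · rw [sum_eq_zero fun k hk => by
      rw [mem_range] at hk
      rw [weightRow, if_neg (by omega)]
      ring]
    simp [betaMat, h]

variable {q : ℂ} {p : ℕ}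

theorem alphaOp_FOp_pow_x0 (h0 : q ≠ 0) (hq : q - q⁻¹ ≠ 0) (h : q ^ p = -1) {k : ℕ}
    (hk : k < p) :
    alphaOp q p ((FOp q (2 * p - 1) ^ k) (x0 (2 * p - 1))) =
      ((-1) ^ k * qfact q k ^ 2) • (EOp q (2 * p - 1) ^ (p - 1 - k)) (xtop (2 * p - 1)) := by
  rw [alphaOp_apply, sum_eq_single_of_mem k (mem_range.2 hk) (fun j _ hj => by
    rw [weightRow_dotProduct_FOp_pow_x0 h0 hq, if_neg hj, mul_zero, zero_smul]),
    weightRow_dotProduct_FOp_pow_x0 h0 hq, if_pos rfl, prod_qint_sub h0 (by omega) h]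
  congr 1
  ring

theorem betaOp_EOp_pow_xtop (h0 : q ≠ 0) (hq : q - q⁻¹ ≠ 0) (h : q ^ p = -1) {m : ℕ}
    (hm : m < p) :
    betaOp q p ((EOp q (2 * p - 1) ^ m) (xtop (2 * p - 1))) =
      ((-1) ^ m * qfact q m ^ 2) • (FOp q (2 * p - 1) ^ (p - 1 - m)) (x0 (2 * p - 1)) := by
  rw [betaOp_apply q (by omega), sum_eq_single_of_mem m (mem_range.2 hm) (fun j hj hne => by
    rw [mem_range] at hj
    rw [weightRow_dotProduct_EOp_pow_xtop h0 hq, if_neg (by omega), mul_zero, zero_smul]),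
    weightRow_dotProduct_EOp_pow_xtop h0 hq, if_pos (by omega), prod_qint_sub h0 (by omega) h]
  congr 1
  ring

theorem neg_one_pow_mul_qfact_sq (h0 : q ≠ 0) (h : q ^ p = -1) {k : ℕ} (hk : k < p) :
    (-1 : ℂ) ^ k * qfact q k ^ 2 * ((-1) ^ (p - 1 - k) * qfact q (p - 1 - k) ^ 2) =
      (-1) ^ (p - 1) * qfact q (p - 1) ^ 2 := by
  have hp : p - 1 - k + k = p - 1 := by omega
  rw [qfact_add_of_pow_eq_neg_one h0 h (m := p - 1 - k) (k := k) (by omega), ← hp, pow_add,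
    hp]
  ring

theorem alphaOp_betaOp_EOp_pow_xtop (h0 : q ≠ 0) (hq : q - q⁻¹ ≠ 0) (h : q ^ p = -1) {m : ℕ}
    (hm : m < p) :
    alphaOp q p (betaOp q p ((EOp q (2 * p - 1) ^ m) (xtop (2 * p - 1)))) =
      ((-1) ^ (p - 1) * qfact q (p - 1) ^ 2) •
        (EOp q (2 * p - 1) ^ m) (xtop (2 * p - 1)) := by
  rw [betaOp_EOp_pow_xtop h0 hq h hm, map_smul, alphaOp_FOp_pow_x0 h0 hq h (by omega),
    smul_smul, neg_one_pow_mul_qfact_sq h0 h hm, Nat.sub_sub_self (by omega)]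

theorem betaOp_alphaOp_FOp_pow_x0 (h0 : q ≠ 0) (hq : q - q⁻¹ ≠ 0) (h : q ^ p = -1) {k : ℕ}
    (hk : k < p) :
    betaOp q p (alphaOp q p ((FOp q (2 * p - 1) ^ k) (x0 (2 * p - 1)))) =
      ((-1) ^ (p - 1) * qfact q (p - 1) ^ 2) •
        (FOp q (2 * p - 1) ^ k) (x0 (2 * p - 1)) := by
  rw [alphaOp_FOp_pow_x0 h0 hq h hk, map_smul, betaOp_EOp_pow_xtop h0 hq h (by omega),
    smul_smul, neg_one_pow_mul_qfact_sq h0 h hk, Nat.sub_sub_self (by omega)]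

end AlphaBeta

theorem exp_pi_mul_I_div_pow {p : ℕ} (hp : p ≠ 0) :
    Complex.exp (Real.pi * Complex.I / p) ^ p = -1 := by
  rw [← Complex.exp_nat_mul, mul_div_cancel₀ _ (Nat.cast_ne_zero.2 hp), Complex.exp_pi_mul_I]

theorem exp_pi_mul_I_div_sub_inv_ne_zero {p : ℕ} (hp : 2 ≤ p) :
    Complex.exp (Real.pi * Complex.I / p) - (Complex.exp (Real.pi * Complex.I / p))⁻¹ ≠ 0 := by
  have hprim := Complex.isPrimitiveRoot_exp (2 * p) (by omega)
  have he : (2 * Real.pi * Complex.I / (2 * p : ℕ) : ℂ) = Real.pi * Complex.I / p := by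
    push_cast
    rw [mul_assoc, mul_div_mul_left _ _ two_ne_zero]
  rw [he] at hprim
  intro h
  have h2 : Complex.exp (Real.pi * Complex.I / p) ^ 2 = 1 := by
    rw [sq]
    nth_rw 1 [sub_eq_zero.1 h]
    exact inv_mul_cancel₀ (Complex.exp_ne_zero _)
  have := Nat.le_of_dvd two_pos (hprim.dvd_of_pow_eq_one 2 h2)
  omega

/-- `α∘β∘α = γ·α` and `β∘α∘β = γ·β` with `γ = (-1)^{p-1}([p-1]!)²`. -/
theorem stmt1 (p : ℕ) (hp : 2 ≤ p) (q : ℂ)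
    (hq : q = Complex.exp (Real.pi * Complex.I / p)) :
    alphaOp q p ∘ₗ betaOp q p ∘ₗ alphaOp q p
        = ((-1 : ℂ) ^ (p - 1) * qfact q (p - 1) ^ 2) • alphaOp q p ∧
      betaOp q p ∘ₗ alphaOp q p ∘ₗ betaOp q p
        = ((-1 : ℂ) ^ (p - 1) * qfact q (p - 1) ^ 2) • betaOp q p := by
  have h0 : q ≠ 0 := hq ▸ Complex.exp_ne_zero _
  have hqi : q - q⁻¹ ≠ 0 := hq ▸ exp_pi_mul_I_div_sub_inv_ne_zero hp
  have hqp : q ^ p = -1 := hq ▸ exp_pi_mul_I_div_pow (by omega)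
  constructor
  · refine LinearMap.ext fun v => ?_
    rw [LinearMap.comp_apply, LinearMap.comp_apply, LinearMap.smul_apply, alphaOp_apply q p v,
      map_sum, map_sum, smul_sum]
    refine sum_congr rfl fun k hk => ?_
    rw [mem_range] at hk
    rw [map_smul, map_smul, alphaOp_betaOp_EOp_pow_xtop h0 hqi hqp (by omega), smul_comm]
  · refine LinearMap.ext fun v => ?_
    rw [LinearMap.comp_apply, LinearMap.comp_apply, LinearMap.smul_apply, betaOp_apply q (by omega) v,
      map_sum, map_sum, smul_sum]
    refine sum_congr rfl fun k hk => ?_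
    rw [mem_range] at hk
    rw [map_smul, map_smul, betaOp_alphaOp_FOp_pow_x0 h0 hqi hqp (by omega), smul_comm]

end
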